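/- If a sequence of estimators Δₙ satisfies the asymptotic compound optimality property (1/n)R(μⁿ, Δₙ) − (1/n)R(μⁿ, Δ*^{μⁿ}) → 0 uniformly over μⁿ ∈ [−C,C]ⁿ, and (1/n)R(μⁿ, Δₙ) is uniformly bounded, then Δₙ is asymptotically empirical Bayes: B(G, Δₙ) − B(G, Δ^G) → 0 for every prior G supported on [−C,C]. -/

import Mathlib

open MeasureTheory ProbabilityTheory Filter

/-- Standard normal density. -/
noncomputable def phi (x : ℝ) : ℝ := (Real.sqrt (2 * Real.pi))⁻¹ * Real.exp (-x ^ 2 / 2)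

/-- Compound (frequentist) risk of an estimator `Δ` at the parameter vector `μ`. -/
noncomputable def compRisk (n : ℕ) (μ : Fin n → ℝ) (Δ : (Fin n → ℝ) → Fin n → ℝ) : ℝ :=
  ∫ y, (∑ i, (Δ y i - μ i) ^ 2) ∂(Measure.pi fun i => gaussianReal (μ i) 1)

/-- Compound risk of a simple symmetric rule `δ`. -/
noncomputable def symmRisk (n : ℕ) (μ : Fin n → ℝ) (δ : ℝ → ℝ) : ℝ :=
  ∫ y, (∑ i, (δ (y i) - μ i) ^ 2) ∂(Measure.pi fun i => gaussianReal (μ i) 1)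

/-- The oracle simple symmetric rule for the vector `μ`. -/
noncomputable def deltaStar (n : ℕ) (μ : Fin n → ℝ) (u : ℝ) : ℝ :=
  (∑ i, μ i * phi (μ i - u)) / (∑ i, phi (μ i - u))

/-- The Bayes (posterior mean) rule under prior `G` for `N(·,1)` noise. -/
noncomputable def deltaBayes (G : Measure ℝ) (u : ℝ) : ℝ :=
  (∫ t, t * phi (t - u) ∂G) / (∫ t, phi (t - u) ∂G)

lemma phi_pos (x : ℝ) : 0 < phi x := by
  unfold phi
  positivity

lemma continuous_phi : Continuous phi := by
  unfold phi
  fun_prop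

lemma gaussianPDFReal_one_eq_phi (t u : ℝ) : gaussianPDFReal t 1 u = phi (t - u) := by
  simp only [gaussianPDFReal, phi, NNReal.coe_one, mul_one]
  rw [sub_sq_comm]

lemma integral_gaussianReal_one_eq (t : ℝ) (f : ℝ → ℝ) :
    ∫ u, f u ∂gaussianReal t 1 = ∫ u, phi (t - u) * f u := by
  rw [integral_gaussianReal_eq_integral_smul one_ne_zero]
  simp only [smul_eq_mul, gaussianPDFReal_one_eq_phi]

lemma integrable_phi_sub (t : ℝ) : Integrable fun u => phi (t - u) := by
  simpa only [← gaussianPDFReal_one_eq_phi] using integrable_gaussianPDFReal t 1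

lemma integral_phi_sub (t : ℝ) : ∫ u, phi (t - u) = 1 := by
  simpa only [← gaussianPDFReal_one_eq_phi] using
    integral_gaussianPDFReal_eq_one t (v := 1) one_ne_zero

/-- An integrable function dominating every unit-variance normal density with mean in
`[-C, C]`. -/
noncomputable def phiEnvelope (C u : ℝ) : ℝ := Real.exp (C ^ 2 / 2) * Real.exp (-(1 / 4) * u ^ 2)

lemma integrable_phiEnvelope (C : ℝ) : Integrable (phiEnvelope C) :=
  (integrable_exp_neg_mul_sq (by norm_num)).const_mul _

lemma phi_sub_le_phiEnvelope {C t : ℝ} (ht : |t| ≤ C) (u : ℝ) :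
    phi (t - u) ≤ phiEnvelope C u := by
  have h1 : (Real.sqrt (2 * Real.pi))⁻¹ ≤ 1 := by
    apply inv_le_one_of_one_le₀
    rw [Real.one_le_sqrt]
    nlinarith [Real.pi_gt_three]
  have h2 : t ^ 2 ≤ C ^ 2 := sq_le_sq' (by linarith [neg_abs_le t]) (le_trans (le_abs_self t) ht)
  unfold phi phiEnvelope
  rw [← Real.exp_add]
  calc _ ≤ 1 * Real.exp (-(t - u) ^ 2 / 2) := by gcongr
    _ ≤ _ := by
      rw [one_mul, Real.exp_le_exp]
      nlinarith [sq_nonneg (2 * t - u)]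

lemma integrable_phi_mul {f : ℝ → ℝ} (hf : Measurable f) {K : ℝ} (hK : ∀ u, |f u| ≤ K) (t : ℝ) :
    Integrable fun u => phi (t - u) * f u := by
  simpa only [mul_comm] using (integrable_phi_sub t).bdd_mul hf.aestronglyMeasurable
    (Eventually.of_forall hK)

lemma abs_integral_phi_mul_le {f : ℝ → ℝ} {K : ℝ} (hK : ∀ u, |f u| ≤ K) (t : ℝ) :
    |∫ u, phi (t - u) * f u| ≤ K := by
  calc |∫ u, phi (t - u) * f u| ≤ ∫ u, phi (t - u) * K := by
        rw [← Real.norm_eq_abs]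
        refine norm_integral_le_of_norm_le ((integrable_phi_sub t).mul_const K)
          (Eventually.of_forall fun u => ?_)
        rw [Real.norm_eq_abs, abs_mul, abs_of_pos (phi_pos _)]
        exact mul_le_mul_of_nonneg_left (hK u) (phi_pos _).le
    _ = K := by rw [integral_mul_const, integral_phi_sub, one_mul]

lemma abs_sq_sub_le {C a t : ℝ} (ha : |a| ≤ C) (ht : |t| ≤ C) : |(a - t) ^ 2| ≤ 4 * C ^ 2 := by
  rw [abs_of_nonneg (sq_nonneg _)]
  rw [abs_le] at ha ht
  nlinarith

section Bayes

variable {ν : Measure ℝ} {C : ℝ}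

lemma integrable_mul_phi_sub [IsFiniteMeasure ν] {f : ℝ → ℝ} (hf : Measurable f) {K : ℝ}
    (hK : ∀ᵐ t ∂ν, |f t| ≤ K) (u : ℝ) : Integrable (fun t => f t * phi (t - u)) ν := by
  have hm : Measurable fun t => phi (t - u) := continuous_phi.measurable.comp (by fun_prop)
  have h1 : ∀ x, phi x ≤ (Real.sqrt (2 * Real.pi))⁻¹ := by
    intro x
    unfold phi
    refine mul_le_of_le_one_right (by positivity) (Real.exp_le_one_iff.2 ?_)
    nlinarith [sq_nonneg x]
  have h2 : Integrable (fun t => phi (t - u)) ν :=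
    Integrable.of_bound hm.aestronglyMeasurable (Real.sqrt (2 * Real.pi))⁻¹
      (Eventually.of_forall fun t => by
        rw [Real.norm_eq_abs, abs_of_pos (phi_pos _)]; exact h1 _)
  exact h2.bdd_mul hf.aestronglyMeasurable hK

lemma measurable_deltaBayes [SFinite ν] : Measurable (deltaBayes ν) := by
  have hp : Measurable fun p : ℝ × ℝ => phi (p.2 - p.1) :=
    continuous_phi.measurable.comp (by fun_prop)
  have hm1 : Measurable fun u => ∫ t, t * phi (t - u) ∂ν :=
    (StronglyMeasurable.integral_prod_right (ν := ν) (f := fun u t => t * phi (t - u))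
      (measurable_snd.mul hp).stronglyMeasurable).measurable
  have hm2 : Measurable fun u => ∫ t, phi (t - u) ∂ν :=
    (StronglyMeasurable.integral_prod_right (ν := ν) (f := fun u t => phi (t - u))
      hp.stronglyMeasurable).measurable
  exact hm1.div hm2

lemma integrable_phi_sub_left [IsFiniteMeasure ν] (u : ℝ) :
    Integrable (fun t => phi (t - u)) ν := by
  simpa using integrable_mul_phi_sub (ν := ν) (f := fun _ => 1) measurable_const
    (K := 1) (by simp) u

lemma abs_integral_mul_phi_le [IsFiniteMeasure ν] (hν : ∀ᵐ t ∂ν, |t| ≤ C) (u : ℝ) :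
    |∫ t, t * phi (t - u) ∂ν| ≤ C * ∫ t, phi (t - u) ∂ν := by
  rw [← integral_const_mul, ← Real.norm_eq_abs]
  refine norm_integral_le_of_norm_le ((integrable_phi_sub_left (ν := ν) u).const_mul C) ?_
  filter_upwards [hν] with t ht
  rw [Real.norm_eq_abs, abs_mul, abs_of_pos (phi_pos _)]
  exact mul_le_mul_of_nonneg_right ht (phi_pos _).le

lemma abs_deltaBayes_le [IsFiniteMeasure ν] (hC : 0 ≤ C) (hν : ∀ᵐ t ∂ν, |t| ≤ C) (u : ℝ) :
    |deltaBayes ν u| ≤ C := by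
  have h0 : 0 ≤ ∫ t, phi (t - u) ∂ν := integral_nonneg fun t => (phi_pos _).le
  unfold deltaBayes
  rw [abs_div, abs_of_nonneg h0]
  exact div_le_of_le_mul₀ h0 hC (abs_integral_mul_phi_le hν u)

lemma deltaBayes_mul_integral_phi [IsFiniteMeasure ν] (hν : ∀ᵐ t ∂ν, |t| ≤ C) (u : ℝ) :
    deltaBayes ν u * ∫ t, phi (t - u) ∂ν = ∫ t, t * phi (t - u) ∂ν := by
  unfold deltaBayes
  by_cases h : ∫ t, phi (t - u) ∂ν = 0
  · have := abs_integral_mul_phi_le hν u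
    rw [h, mul_zero] at this ⊢
    exact (abs_nonpos_iff.1 this).symm
  · exact div_mul_cancel₀ _ h

lemma integrable_phi_mul_prod [IsFiniteMeasure ν] (hν : ∀ᵐ t ∂ν, |t| ≤ C) {w : ℝ × ℝ → ℝ}
    (hw : Measurable w) {K : ℝ} (hK : ∀ t u, |t| ≤ C → |w (t, u)| ≤ K) :
    Integrable (fun p : ℝ × ℝ => phi (p.1 - p.2) * w p) (ν.prod volume) := by
  have hp : Measurable fun p : ℝ × ℝ => phi (p.1 - p.2) :=
    continuous_phi.measurable.comp (by fun_prop)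
  have henv : Integrable (fun p : ℝ × ℝ => phiEnvelope C p.2 * K) (ν.prod volume) :=
    ((integrable_phiEnvelope C).comp_snd ν).mul_const K
  refine henv.mono' (hp.mul hw).aestronglyMeasurable ?_
  filter_upwards [Measure.quasiMeasurePreserving_fst.ae hν] with p h
  rw [Real.norm_eq_abs, abs_mul, abs_of_pos (phi_pos _)]
  exact mul_le_mul (phi_sub_le_phiEnvelope h _) (hK _ _ h) (abs_nonneg _)
    ((phi_pos _).le.trans (phi_sub_le_phiEnvelope h _))

/-- The posterior mean minimizes the integrated squared error risk among bounded rules. -/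
lemma integral_loss_deltaBayes_le [IsFiniteMeasure ν] (hC : 0 ≤ C) (hν : ∀ᵐ t ∂ν, |t| ≤ C)
    {b : ℝ → ℝ} (hb : Measurable b) (hbC : ∀ u, |b u| ≤ C) :
    ∫ t, (∫ u, phi (t - u) * (deltaBayes ν u - t) ^ 2) ∂ν
      ≤ ∫ t, (∫ u, phi (t - u) * (b u - t) ^ 2) ∂ν := by
  have hd : Measurable (deltaBayes ν) := measurable_deltaBayes
  have hdC := abs_deltaBayes_le hC hν
  have key : ∀ {f : ℝ → ℝ}, Measurable f → (∀ u, |f u| ≤ C) →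
      Integrable (fun p : ℝ × ℝ => phi (p.1 - p.2) * (f p.2 - p.1) ^ 2) (ν.prod volume) :=
    fun hf hfC => integrable_phi_mul_prod hν (w := fun p => (_ - p.1) ^ 2)
      (((hf.comp measurable_snd).sub measurable_fst).pow_const 2)
      fun t u ht => abs_sq_sub_le (hfC u) ht
  have swap := fun {f : ℝ → ℝ} (hf : Measurable f) (hfC : ∀ u, |f u| ≤ C) =>
    integral_integral_swap (f := fun t u => phi (t - u) * (f u - t) ^ 2) (key hf hfC)
  rw [swap hd hdC, swap hb hbC]
  refine integral_mono (key hd hdC).integral_prod_right (key hb hbC).integral_prod_right fun u => ?_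
  have i0 : Integrable (fun t => phi (t - u)) ν := integrable_phi_sub_left u
  have i1 : Integrable (fun t => t * phi (t - u)) ν :=
    integrable_mul_phi_sub measurable_id hν u
  have i2 : ∀ a : ℝ, |a| ≤ C → Integrable (fun t => phi (t - u) * (a - t) ^ 2) ν := fun a ha => by
    simpa only [mul_comm] using integrable_mul_phi_sub (ν := ν) (f := fun t => (a - t) ^ 2)
      (K := 4 * C ^ 2) (by fun_prop) (hν.mono fun t ht => abs_sq_sub_le ha ht) u
  have e : ∫ t, phi (t - u) * (b u - t) ^ 2 ∂ν - ∫ t, phi (t - u) * (deltaBayes ν u - t) ^ 2 ∂ν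
      = (b u - deltaBayes ν u) ^ 2 * ∫ t, phi (t - u) ∂ν := by
    rw [← integral_sub (i2 _ (hbC u)) (i2 _ (hdC u))]
    calc _ = ∫ t, ((b u ^ 2 - deltaBayes ν u ^ 2) * phi (t - u)
            - 2 * (b u - deltaBayes ν u) * (t * phi (t - u))) ∂ν := by
          congr 1; ext t; ring
      _ = _ := by
          rw [integral_sub (i0.const_mul _) (i1.const_mul _), integral_const_mul,
            integral_const_mul, ← deltaBayes_mul_integral_phi hν u]
          ring
  have h0 : 0 ≤ ∫ t, phi (t - u) ∂ν := integral_nonneg fun t => (phi_pos _).le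
  have := mul_nonneg (sq_nonneg (b u - deltaBayes ν u)) h0
  simp only
  linarith

end Bayes

lemma integral_sum_dirac {n : ℕ} (M : Fin n → ℝ) (f : ℝ → ℝ) :
    ∫ t, f t ∂(∑ i, Measure.dirac (M i)) = ∑ i, f (M i) := by
  rw [integral_finsetSum_measure fun i _ => integrable_dirac enorm_lt_top]
  simp only [integral_dirac]

lemma deltaStar_eq_deltaBayes (n : ℕ) (M : Fin n → ℝ) :
    deltaStar n M = deltaBayes (∑ i, Measure.dirac (M i)) := by
  ext u
  unfold deltaStar deltaBayes
  simp only [integral_sum_dirac]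

lemma ae_sum_dirac {n : ℕ} {M : Fin n → ℝ} {C : ℝ} (hM : ∀ i, |M i| ≤ C) :
    ∀ᵐ t ∂(∑ i, Measure.dirac (M i)), |t| ≤ C := by
  rw [ae_iff]
  simp only [Measure.coe_finsetSum, Finset.sum_apply]
  refine Finset.sum_eq_zero fun i _ => ?_
  have : ∀ᵐ t ∂(Measure.dirac (M i)), |t| ≤ C := by rw [ae_dirac_eq]; exact hM i
  exact ae_iff.1 this

lemma abs_deltaStar_le {n : ℕ} {M : Fin n → ℝ} {C : ℝ} (hC : 0 ≤ C) (hM : ∀ i, |M i| ≤ C) (u : ℝ) :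
    |deltaStar n M u| ≤ C := by
  rw [deltaStar_eq_deltaBayes]
  exact abs_deltaBayes_le hC (ae_sum_dirac hM) u

lemma measurable_deltaStar_uncurry (n : ℕ) :
    Measurable fun p : (Fin n → ℝ) × ℝ => deltaStar n p.1 p.2 := by
  have hp : ∀ i, Measurable fun p : (Fin n → ℝ) × ℝ => phi (p.1 i - p.2) :=
    fun i => continuous_phi.measurable.comp (by fun_prop)
  have hi : ∀ i, Measurable fun p : (Fin n → ℝ) × ℝ => p.1 i := fun i => by fun_prop
  unfold deltaStar
  exact (Finset.measurable_sum _ fun i _ => (hi i).mul (hp i)).div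
    (Finset.measurable_sum _ fun i _ => hp i)

lemma measurable_deltaStar (n : ℕ) (M : Fin n → ℝ) : Measurable (deltaStar n M) :=
  (measurable_deltaStar_uncurry n).comp (measurable_const.prodMk measurable_id)

lemma symmRisk_eq_sum {n : ℕ} {M : Fin n → ℝ} {C : ℝ} (hM : ∀ i, |M i| ≤ C) {δ : ℝ → ℝ}
    (hδ : Measurable δ) (hδC : ∀ u, |δ u| ≤ C) :
    symmRisk n M δ = ∑ i, ∫ u, phi (M i - u) * (δ u - M i) ^ 2 := by
  unfold symmRisk
  have hm : ∀ i, Measurable fun u => (δ u - M i) ^ 2 := fun i => (hδ.sub_const _).pow_const 2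
  rw [integral_finsetSum]
  · refine Finset.sum_congr rfl fun i _ => ?_
    rw [← integral_gaussianReal_one_eq]
    have h := measurePreserving_eval (fun i => gaussianReal (M i) 1) i
    conv_rhs => rw [← h.map_eq]
    rw [integral_map h.measurable.aemeasurable (hm i).aestronglyMeasurable]
  · intro i _
    exact Integrable.of_bound ((hm i).comp (measurable_pi_apply i)).aestronglyMeasurable (4 * C ^ 2)
      (Eventually.of_forall fun y => abs_sq_sub_le (hδC _) (hM i))

lemma symmRisk_deltaStar_le {n : ℕ} {M : Fin n → ℝ} {C : ℝ} (hC : 0 ≤ C) (hM : ∀ i, |M i| ≤ C)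
    {δ : ℝ → ℝ} (hδ : Measurable δ) (hδC : ∀ u, |δ u| ≤ C) :
    symmRisk n M (deltaStar n M) ≤ symmRisk n M δ := by
  have h := integral_loss_deltaBayes_le hC (ae_sum_dirac hM) hδ hδC
  rw [← deltaStar_eq_deltaBayes, integral_sum_dirac, integral_sum_dirac] at h
  rw [symmRisk_eq_sum hM (measurable_deltaStar n M) (abs_deltaStar_le hC hM),
    symmRisk_eq_sum hM hδ hδC]
  exact h

/-- Replacing the oracle rule by its leave-one-out version in every coordinate increases the total
loss at an observation by at most a multiple of the envelope of the densities. -/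
lemma sum_leaveOneOut_loss_le {k : ℕ} {M : Fin (k + 1) → ℝ} {C : ℝ} (hC : 0 ≤ C)
    (hM : ∀ i, |M i| ≤ C) (u : ℝ) :
    ∑ i, phi (M i - u) * (deltaStar k (i.removeNth M) u - M i) ^ 2
      ≤ ∑ i, phi (M i - u) * (deltaStar (k + 1) M u - M i) ^ 2
        + 8 * C ^ 2 * phiEnvelope C u := by
  set S := ∑ j, phi (M j - u) with hS
  set a := deltaStar (k + 1) M u with ha
  have hSpos : 0 < S := Finset.sum_pos (fun j _ => phi_pos _) Finset.univ_nonempty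
  have haC : |a| ≤ C := abs_deltaStar_le hC hM u
  have haS : a * S = ∑ j, M j * phi (M j - u) := div_mul_cancel₀ _ hSpos.ne'
  have term : ∀ i, phi (M i - u) * (deltaStar k (i.removeNth M) u - M i) ^ 2
      ≤ phi (M i - u) * (a - M i) ^ 2 + 8 * C ^ 2 * phiEnvelope C u * (phi (M i - u) / S) := by
    intro i
    set b := deltaStar k (i.removeNth M) u with hb
    have hbC : |b| ≤ C := abs_deltaStar_le hC (fun j => hM _) u
    have hbD : b * ∑ j : Fin k, phi (M (i.succAbove j) - u)
        = ∑ j : Fin k, M (i.succAbove j) * phi (M (i.succAbove j) - u) := by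
      have := deltaBayes_mul_integral_phi
        (ae_sum_dirac (M := i.removeNth M) (C := C) fun j => hM _) u
      rwa [← deltaStar_eq_deltaBayes, integral_sum_dirac, integral_sum_dirac] at this
    rw [Fin.sum_univ_succAbove _ i] at haS hS
    have hdiff : a - b = phi (M i - u) / S * (M i - b) := by
      field_simp
      rw [← hbD] at haS
      rw [sub_mul, haS, hS]
      ring
    have hp := phi_pos (M i - u)
    have hr : 0 ≤ phi (M i - u) / S := by positivity
    have hle := phi_sub_le_phiEnvelope (hM i) u
    have hbb : (b - M i) ^ 2 - (a - M i) ^ 2 ≤ 8 * C ^ 2 * (phi (M i - u) / S) := by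
      have e : (b - M i) ^ 2 - (a - M i) ^ 2
          = phi (M i - u) / S * ((b - M i) * (a + b - 2 * M i)) := by
        linear_combination (-(a + b - 2 * M i)) * hdiff
      rw [e, mul_comm]
      refine mul_le_mul_of_nonneg_right ?_ hr
      have h1 : |b - M i| ≤ 2 * C := (abs_sub _ _).trans (by linarith [hM i])
      have h2 : |a + b - 2 * M i| ≤ 4 * C := by
        have := hM i
        rw [abs_le] at *
        constructor <;> linarith [this.1, this.2]
      calc _ ≤ |b - M i| * |a + b - 2 * M i| := by rw [← abs_mul]; exact le_abs_self _
        _ ≤ 2 * C * (4 * C) := by gcongr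
        _ = _ := by ring
    have h3 : phi (M i - u) * (8 * C ^ 2 * (phi (M i - u) / S))
        ≤ phiEnvelope C u * (8 * C ^ 2 * (phi (M i - u) / S)) := by gcongr
    have h4 := mul_le_mul_of_nonneg_left hbb hp.le
    linarith
  calc _ ≤ ∑ i, (phi (M i - u) * (a - M i) ^ 2
        + 8 * C ^ 2 * phiEnvelope C u * (phi (M i - u) / S)) := Finset.sum_le_sum fun i _ => term i
    _ = _ := by
      rw [Finset.sum_add_distrib, ← Finset.mul_sum, ← Finset.sum_div, ← hS, div_self hSpos.ne',
        mul_one]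

lemma integrable_phi_mul_sq_sub {δ : ℝ → ℝ} {C t : ℝ} (hδ : Measurable δ) (hδC : ∀ u, |δ u| ≤ C)
    (ht : |t| ≤ C) : Integrable fun u => phi (t - u) * (δ u - t) ^ 2 :=
  integrable_phi_mul ((hδ.sub_const t).pow_const 2) (fun u => abs_sq_sub_le (hδC u) ht) t

lemma sum_leaveOneOut_risk_le {k : ℕ} {M : Fin (k + 1) → ℝ} {C : ℝ} (hC : 0 ≤ C)
    (hM : ∀ i, |M i| ≤ C) :
    ∑ i, ∫ u, phi (M i - u) * (deltaStar k (i.removeNth M) u - M i) ^ 2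
      ≤ symmRisk (k + 1) M (deltaStar (k + 1) M) + 8 * C ^ 2 * ∫ u, phiEnvelope C u := by
  have i1 : ∀ i, Integrable fun u => phi (M i - u) * (deltaStar k (i.removeNth M) u - M i) ^ 2 :=
    fun i => integrable_phi_mul_sq_sub (measurable_deltaStar _ _)
      (abs_deltaStar_le hC fun j => hM _) (hM i)
  have i2 : ∀ i, Integrable fun u => phi (M i - u) * (deltaStar (k + 1) M u - M i) ^ 2 :=
    fun i => integrable_phi_mul_sq_sub (measurable_deltaStar _ _) (abs_deltaStar_le hC hM) (hM i)
  have i3 := (integrable_phiEnvelope C).const_mul (8 * C ^ 2)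
  rw [symmRisk_eq_sum hM (measurable_deltaStar _ _) (abs_deltaStar_le hC hM),
    ← integral_finsetSum _ fun i _ => i1 i, ← integral_finsetSum _ fun i _ => i2 i,
    ← integral_const_mul, ← integral_add (integrable_finsetSum _ fun i _ => i2 i) i3]
  exact integral_mono (integrable_finsetSum _ fun i _ => i1 i)
    ((integrable_finsetSum _ fun i _ => i2 i).add i3) (sum_leaveOneOut_loss_le hC hM)

lemma measurable_compRisk {n : ℕ} {Δ : (Fin n → ℝ) → Fin n → ℝ} (hΔ : Measurable Δ) :
    Measurable fun M => compRisk n M Δ := by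
  have hloss : ∀ M : Fin n → ℝ, Measurable fun y => ∑ i, (Δ y i - M i) ^ 2 := fun M =>
    Finset.measurable_sum _ fun i _ => (((measurable_pi_apply i).comp hΔ).sub_const _).pow_const 2
  have e : ∀ M : Fin n → ℝ, compRisk n M Δ
      = ∫ z, ∑ i, (Δ (fun j => M j + z j) i - M i) ^ 2
          ∂(Measure.pi fun _ : Fin n => gaussianReal 0 1) := by
    intro M
    have h := measurePreserving_pi (fun _ : Fin n => gaussianReal 0 1)
      (fun i => gaussianReal (M i) 1) (f := fun i x => M i + x)
      fun i => ⟨by fun_prop, by rw [gaussianReal_map_const_add, zero_add]⟩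
    unfold compRisk
    rw [← h.map_eq, integral_map h.measurable.aemeasurable (hloss M).aestronglyMeasurable]
  simp only [e]
  refine (StronglyMeasurable.integral_prod_right
    (f := fun (M z : Fin n → ℝ) => ∑ i, (Δ (fun j => M j + z j) i - M i) ^ 2)
    (Measurable.stronglyMeasurable ?_)).measurable
  refine Finset.measurable_sum _ fun i _ => Measurable.pow_const (Measurable.sub ?_ ?_) 2
  · exact (measurable_pi_apply i).comp (hΔ.comp (by fun_prop))
  · fun_prop

section Prior

variable {G : Measure ℝ} [IsProbabilityMeasure G] {C : ℝ}

lemma ae_pi_abs_le (hG : ∀ᵐ t ∂G, |t| ≤ C) (n : ℕ) :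
    ∀ᵐ M ∂(Measure.pi fun _ : Fin n => G), ∀ i, |M i| ≤ C :=
  ae_all_iff.2 fun i => (measurePreserving_eval (fun _ : Fin n => G) i).quasiMeasurePreserving.ae hG

/-- The Bayes risk in the one-dimensional problem. -/
noncomputable def bayesRisk (G : Measure ℝ) : ℝ :=
  ∫ t, (∫ u, phi (t - u) * (deltaBayes G u - t) ^ 2) ∂G

lemma measurable_loss_integral {α : Type*} [MeasurableSpace α] {f : α → ℝ → ℝ} {m : α → ℝ}
    (hf : Measurable (Function.uncurry f)) (hm : Measurable m) :
    Measurable fun x => ∫ u, phi (m x - u) * (f x u - m x) ^ 2 := by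
  have hm' : Measurable fun p : α × ℝ => m p.1 := hm.comp measurable_fst
  refine (StronglyMeasurable.integral_prod_right (ν := volume)
    (f := fun x u => phi (m x - u) * (f x u - m x) ^ 2)
    (Measurable.stronglyMeasurable ?_)).measurable
  exact (continuous_phi.measurable.comp (hm'.sub measurable_snd)).mul ((hf.sub hm').pow_const 2)

lemma integral_symmRisk_deltaBayes (hC : 0 ≤ C) (hG : ∀ᵐ t ∂G, |t| ≤ C) (n : ℕ) :
    Integrable (fun M => symmRisk n M (deltaBayes G)) (Measure.pi fun _ : Fin n => G) ∧
    ∫ M, symmRisk n M (deltaBayes G) ∂(Measure.pi fun _ : Fin n => G) = n * bayesRisk G := by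
  have hd := measurable_deltaBayes (ν := G)
  have hdC := abs_deltaBayes_le hC hG
  set ρ : ℝ → ℝ := fun t => ∫ u, phi (t - u) * (deltaBayes G u - t) ^ 2 with hρ
  have hρm : Measurable ρ :=
    measurable_loss_integral (f := fun _ => deltaBayes G) (hd.comp measurable_snd) measurable_id
  have hρi : Integrable ρ G := Integrable.of_bound hρm.aestronglyMeasurable (4 * C ^ 2)
    (hG.mono fun t ht => abs_integral_phi_mul_le (fun u => abs_sq_sub_le (hdC u) ht) t)
  have hmp := measurePreserving_eval (fun _ : Fin n => G)
  have hi : ∀ i, Integrable (fun M : Fin n → ℝ => ρ (M i)) (Measure.pi fun _ : Fin n => G) :=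
    fun i => (hmp i).integrable_comp_of_integrable hρi
  have e : (fun M => symmRisk n M (deltaBayes G)) =ᵐ[Measure.pi fun _ : Fin n => G]
      fun M => ∑ i, ρ (M i) :=
    (ae_pi_abs_le hG n).mono fun M hM => symmRisk_eq_sum hM hd hdC
  refine ⟨(integrable_finsetSum _ fun i _ => hi i).congr e.symm, ?_⟩
  rw [integral_congr_ae e, integral_finsetSum _ fun i _ => hi i]
  have : ∀ i, ∫ M : Fin n → ℝ, ρ (M i) ∂(Measure.pi fun _ : Fin n => G) = bayesRisk G := by
    intro i
    change _ = ∫ t, ρ t ∂G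
    conv_rhs => rw [← (hmp i).map_eq]
    rw [integral_map (hmp i).measurable.aemeasurable hρm.aestronglyMeasurable]
  simp [this]

lemma integrable_symmRisk_deltaStar (hC : 0 ≤ C) (hG : ∀ᵐ t ∂G, |t| ≤ C) (n : ℕ) :
    Integrable (fun M => symmRisk n M (deltaStar n M)) (Measure.pi fun _ : Fin n => G) := by
  have e : (fun M => symmRisk n M (deltaStar n M)) =ᵐ[Measure.pi fun _ : Fin n => G]
      fun M => ∑ i, ∫ u, phi (M i - u) * (deltaStar n M u - M i) ^ 2 :=
    (ae_pi_abs_le hG n).mono fun M hM =>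
      symmRisk_eq_sum hM (measurable_deltaStar n M) (abs_deltaStar_le hC hM)
  refine Integrable.congr (integrable_finsetSum _ fun i _ => ?_) e.symm
  refine Integrable.of_bound (measurable_loss_integral (measurable_deltaStar_uncurry n)
    (measurable_pi_apply i)).aestronglyMeasurable (4 * C ^ 2) ?_
  filter_upwards [ae_pi_abs_le hG n] with M hM
  exact abs_integral_phi_mul_le (fun u => abs_sq_sub_le (abs_deltaStar_le hC hM u) (hM i)) _

lemma bayesRisk_le_integral_leaveOneOut (hC : 0 ≤ C) (hG : ∀ᵐ t ∂G, |t| ≤ C) {k : ℕ}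
    (i : Fin (k + 1)) :
    Integrable (fun M : Fin (k + 1) → ℝ =>
      ∫ u, phi (M i - u) * (deltaStar k (i.removeNth M) u - M i) ^ 2)
      (Measure.pi fun _ : Fin (k + 1) => G) ∧
    bayesRisk G ≤ ∫ M, (∫ u, phi (M i - u) * (deltaStar k (i.removeNth M) u - M i) ^ 2)
      ∂(Measure.pi fun _ : Fin (k + 1) => G) := by
  set g : ℝ × (Fin k → ℝ) → ℝ := fun p => ∫ u, phi (p.1 - u) * (deltaStar k p.2 u - p.1) ^ 2
    with hg
  have hmp := measurePreserving_piFinSuccAbove (fun _ : Fin (k + 1) => G) i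
  have hgm : Measurable g := measurable_loss_integral
    (f := fun (p : ℝ × (Fin k → ℝ)) u => deltaStar k p.2 u)
    ((measurable_deltaStar_uncurry k).comp
      ((measurable_snd.comp measurable_fst).prodMk measurable_snd)) measurable_fst
  have hgi : Integrable g (G.prod (Measure.pi fun _ : Fin k => G)) := by
    refine Integrable.of_bound hgm.aestronglyMeasurable (4 * C ^ 2) ?_
    filter_upwards [Measure.quasiMeasurePreserving_fst.ae hG,
      Measure.quasiMeasurePreserving_snd.ae (ae_pi_abs_le hG k)] with p h1 h2
    exact abs_integral_phi_mul_le (fun u => abs_sq_sub_le (abs_deltaStar_le hC h2 u) h1) _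
  refine ⟨hmp.integrable_comp_of_integrable hgi, ?_⟩
  have e := hmp.integral_comp' g
  change _ ≤ ∫ M, g (MeasurableEquiv.piFinSuccAbove (fun _ => ℝ) i M)
    ∂(Measure.pi fun _ : Fin (k + 1) => G)
  rw [e, integral_prod_symm _ hgi]
  calc bayesRisk G = ∫ _, bayesRisk G ∂(Measure.pi fun _ : Fin k => G) := by simp
    _ ≤ _ := by
      refine integral_mono_ae (integrable_const _) hgi.integral_prod_right ?_
      filter_upwards [ae_pi_abs_le hG k] with M hM
      exact integral_loss_deltaBayes_le hC hG (measurable_deltaStar k M) (abs_deltaStar_le hC hM)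

/-- The expected average risk of the oracle simple symmetric rule is within `O(1 / n)` of the
Bayes risk. -/
lemma abs_integral_symmRisk_deltaStar_sub_le (hC : 0 ≤ C) (hG : ∀ᵐ t ∂G, |t| ≤ C) (n : ℕ) :
    |∫ M, symmRisk n M (deltaStar n M) ∂(Measure.pi fun _ : Fin n => G)
      - ∫ M, symmRisk n M (deltaBayes G) ∂(Measure.pi fun _ : Fin n => G)|
      ≤ 8 * C ^ 2 * ∫ u, phiEnvelope C u := by
  have hK : 0 ≤ 8 * C ^ 2 * ∫ u, phiEnvelope C u :=
    mul_nonneg (by positivity) (integral_nonneg fun u => by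
      simp only [phiEnvelope, Pi.zero_apply]; positivity)
  have hs := integrable_symmRisk_deltaStar hC hG n
  obtain ⟨hbi, hb⟩ := integral_symmRisk_deltaBayes hC hG n
  have hup := integral_mono_ae hs hbi ((ae_pi_abs_le hG n).mono fun M hM =>
    symmRisk_deltaStar_le hC hM measurable_deltaBayes (abs_deltaBayes_le hC hG))
  refine abs_le.2 ⟨?_, by linarith⟩
  rw [hb]
  cases n with
  | zero => simpa [symmRisk] using hK
  | succ k =>
    have hl := bayesRisk_le_integral_leaveOneOut hC hG (k := k)
    have h1 : ((k + 1 : ℕ) : ℝ) * bayesRisk G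
        ≤ ∑ i : Fin (k + 1), ∫ M, (∫ u, phi (M i - u) * (deltaStar k (i.removeNth M) u - M i) ^ 2)
          ∂(Measure.pi fun _ : Fin (k + 1) => G) := by
      calc _ = ∑ _i : Fin (k + 1), bayesRisk G := by simp
        _ ≤ _ := Finset.sum_le_sum fun i _ => (hl i).2
    rw [← integral_finsetSum _ fun i _ => (hl i).1] at h1
    have h2 := integral_mono_ae (integrable_finsetSum _ fun i _ => (hl i).1)
      (hs.add (integrable_const (8 * C ^ 2 * ∫ u, phiEnvelope C u)))
      ((ae_pi_abs_le hG (k + 1)).mono fun M hM => by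
        simpa using sum_leaveOneOut_risk_le hC hM)
    rw [integral_add' hs (integrable_const _)] at h2
    simp only [integral_const, probReal_univ, one_smul] at h2
    linarith

end Prior

/-- if `(1/n)R(μⁿ, Δₙ) - (1/n)R(μⁿ, Δ*^{μⁿ}) → 0` uniformly over
`μⁿ ∈ [-C,C]ⁿ` and the average risks `(1/n)R(μⁿ, Δₙ)` are uniformly bounded there, then
`Δₙ` is asymptotically empirical Bayes: `B(G, Δₙ) - B(G, Δ^G) → 0` for every prior `G`
supported on `[-C, C]`. -/
theorem compound_optimal_implies_empirical_bayes
    (C : ℝ) (hC : 0 < C)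
    (Δ : (n : ℕ) → (Fin n → ℝ) → Fin n → ℝ)
    (hΔmeas : ∀ n, Measurable (Δ n))
    (hunif : ∀ ε > (0 : ℝ), ∃ N : ℕ, ∀ n ≥ N, ∀ μ : Fin n → ℝ,
      (∀ i, |μ i| ≤ C) →
        |(1 / (n : ℝ)) * compRisk n μ (Δ n)
          - (1 / (n : ℝ)) * symmRisk n μ (deltaStar n μ)| ≤ ε)
    (hbdd : ∃ B : ℝ, ∀ n : ℕ, ∀ μ : Fin n → ℝ, (∀ i, |μ i| ≤ C) →
      (1 / (n : ℝ)) * compRisk n μ (Δ n) ≤ B)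
    (G : Measure ℝ) [IsProbabilityMeasure G] (hsupp : ∀ᵐ u ∂G, |u| ≤ C) :
    Tendsto (fun n : ℕ =>
        (∫ M, (1 / (n : ℝ)) * compRisk n M (Δ n) ∂(Measure.pi fun _ : Fin n => G))
          - ∫ M, (1 / (n : ℝ)) * symmRisk n M (deltaBayes G)
              ∂(Measure.pi fun _ : Fin n => G))
      atTop (nhds 0) := by
  set K := 8 * C ^ 2 * ∫ u, phiEnvelope C u
  rw [Metric.tendsto_atTop]
  intro ε hε
  obtain ⟨N, hN⟩ := hunif (ε / 2) (by positivity)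
  obtain ⟨m, hm⟩ := exists_nat_gt (K / (ε / 2))
  refine ⟨max N (m + 1), fun n hn => ?_⟩
  have hnN : N ≤ n := (le_max_left _ _).trans hn
  have hnm : m + 1 ≤ n := (le_max_right _ _).trans hn
  have hmn : ((m : ℝ) + 1) ≤ n := by exact_mod_cast hnm
  have hn0 : (0 : ℝ) < n := by linarith [(Nat.cast_nonneg m : (0 : ℝ) ≤ m)]
  have hs := (integrable_symmRisk_deltaStar hC.le hsupp n).const_mul (1 / (n : ℝ))
  have hclose : ∀ᵐ M ∂(Measure.pi fun _ : Fin n => G),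
      |(1 / (n : ℝ)) * compRisk n M (Δ n)
          - (1 / (n : ℝ)) * symmRisk n M (deltaStar n M)| ≤ ε / 2 :=
    (ae_pi_abs_le hsupp n).mono fun M hM => hN n hnN M hM
  have hcm := (measurable_compRisk (hΔmeas n)).const_mul (1 / (n : ℝ))
  have hd : Integrable (fun M => (1 / (n : ℝ)) * compRisk n M (Δ n)
      - (1 / (n : ℝ)) * symmRisk n M (deltaStar n M)) (Measure.pi fun _ : Fin n => G) :=
    Integrable.of_bound (hcm.aestronglyMeasurable.sub hs.aestronglyMeasurable) (ε / 2) hclose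
  have hc : Integrable (fun M => (1 / (n : ℝ)) * compRisk n M (Δ n))
      (Measure.pi fun _ : Fin n => G) := by
    simpa only [Pi.add_def, sub_add_cancel] using hd.add hs
  have h1 := norm_integral_le_of_norm_le_const (f := fun M => (1 / (n : ℝ)) * compRisk n M (Δ n)
    - (1 / (n : ℝ)) * symmRisk n M (deltaStar n M)) hclose
  rw [integral_sub hc hs, probReal_univ, mul_one, Real.norm_eq_abs] at h1
  have h2 := abs_integral_symmRisk_deltaStar_sub_le hC.le hsupp n
  have h3 : |∫ M, (1 / (n : ℝ)) * symmRisk n M (deltaStar n M) ∂(Measure.pi fun _ : Fin n => G)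
      - ∫ M, (1 / (n : ℝ)) * symmRisk n M (deltaBayes G) ∂(Measure.pi fun _ : Fin n => G)|
      < ε / 2 := by
    rw [integral_const_mul, integral_const_mul, ← mul_sub, abs_mul,
      abs_of_pos (one_div_pos.2 hn0), one_div_mul_eq_div, div_lt_iff₀ hn0]
    rw [div_lt_iff₀ (by positivity)] at hm
    nlinarith
  rw [Real.dist_eq, sub_zero]
  calc _ ≤ _ := abs_sub_le _ (∫ M, (1 / (n : ℝ)) * symmRisk n M (deltaStar n M)
        ∂(Measure.pi fun _ : Fin n => G)) _
    _ < ε := by linarith
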